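/- Let Ω_ε be the dumbbell family with λ₁(Ω₁) < λ₁(Ω₂), let ε_i ↓ 0, let φ_{1,ε_i} be positive L²-normalized first Dirichlet eigenfunctions of Ω_{ε_i} extended by zero to ℝⁿ, and let φ_{1,0} be the zero-extension of the positive L²-normalized first Dirichlet eigenfunction of Ω₁. Assume λ₁(Ω_{ε_i}) → λ₁(Ω₁) and ‖φ_{1,ε_i} − φ_{1,0}‖_{L²(ℝⁿ)} → 0 as i → ∞. Then sup_{x ∈ Ω₂} |φ_{1,ε_i}(x)| → 0 as i → ∞. -/

import Mathlib

open Set MeasureTheory Metric Filter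

noncomputable section

abbrev ESp (k : ℕ) : Type := EuclideanSpace ℝ (Fin k)

/-- The Laplacian of a real-valued function on Euclidean space,
as the sum of the second derivatives along the coordinate directions. -/
def lap {k : ℕ} (f : ESp k → ℝ) (x : ESp k) : ℝ :=
  ∑ i : Fin k, fderiv ℝ (fun y => fderiv ℝ f y (EuclideanSpace.single i 1)) x
      (EuclideanSpace.single i 1)

/-- First Dirichlet eigenvalue as the infimum of the Rayleigh quotient over
nonzero smooth compactly supported test functions. -/
def dirEig1 {k : ℕ} (U : Set (ESp k)) : ℝ :=
  sInf { r : ℝ | ∃ u : ESp k → ℝ, ContDiff ℝ (⊤ : ℕ∞) u ∧ HasCompactSupport u ∧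
    tsupport u ⊆ U ∧ u ≠ 0 ∧
    r = (∫ x in U, ‖fderiv ℝ u x‖ ^ 2) / (∫ x in U, u x ^ 2) }

/-- A first Dirichlet eigenfunction of `U`. -/
def IsFirstDirEigenfun {k : ℕ} (U : Set (ESp k)) (φ : ESp k → ℝ) : Prop :=
  (∃ x ∈ U, φ x ≠ 0) ∧ ContDiffOn ℝ 2 φ U ∧ ContinuousOn φ (closure U) ∧
  (∀ x ∈ U, lap φ x + dirEig1 U * φ x = 0) ∧
  (∀ x ∈ frontier U, φ x = 0)

/-- A set has smooth boundary: it is the sublevel set of a smooth defining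
function with nonvanishing differential on the boundary. -/
def HasSmoothBoundary {k : ℕ} (Ω : Set (ESp k)) : Prop :=
  ∃ f : ESp k → ℝ, ContDiff ℝ (⊤ : ℕ∞) f ∧ Ω = f ⁻¹' (Iio 0) ∧
    ∀ x ∈ frontier Ω, fderiv ℝ f x ≠ 0

/-- The Euclidean norm `|x'|` of the last `m+1` coordinates of `x ∈ ℝ^(m+2)`. -/
def primeNorm {m : ℕ} (x : ESp (m + 2)) : ℝ :=
  Real.sqrt (∑ i : Fin (m + 1), x i.succ ^ 2)

/-- The data of the dumbbell construction: two bounded disjoint open base domains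
`Ω₁, Ω₂ ⊂ ℝ^(m+2)` with smooth boundary and flat boundary portions at `x₁ = -1`
(resp. `x₁ = 1`), and a smooth bump profile `ρ`. -/
structure Dumbbell (m : ℕ) where
  Ω₁ : Set (ESp (m + 2))
  Ω₂ : Set (ESp (m + 2))
  ξ : ℝ
  ρ : ℝ → ℝ
  hξ : 0 < ξ
  open₁ : IsOpen Ω₁
  open₂ : IsOpen Ω₂
  bounded₁ : Bornology.IsBounded Ω₁
  bounded₂ : Bornology.IsBounded Ω₂
  disj : Disjoint Ω₁ Ω₂
  smooth₁ : HasSmoothBoundary Ω₁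
  smooth₂ : HasSmoothBoundary Ω₂
  flat₁ : closure Ω₁ ∩ {x | -1 ≤ x 0 ∧ primeNorm x < 3 * ξ}
        = {x | x 0 = -1 ∧ primeNorm x < 3 * ξ}
  flat₁' : {x : ESp (m + 2) | x 0 = -1 ∧ primeNorm x < 3 * ξ} ⊆ frontier Ω₁
  flat₂ : closure Ω₂ ∩ {x | x 0 ≤ 1 ∧ primeNorm x < 3 * ξ}
        = {x | x 0 = 1 ∧ primeNorm x < 3 * ξ}
  flat₂' : {x : ESp (m + 2) | x 0 = 1 ∧ primeNorm x < 3 * ξ} ⊆ frontier Ω₂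
  ρ_pos : ∀ q ∈ Set.Ioc (-2 : ℝ) 0, 0 < ρ q
  ρ_smooth : ContDiffOn ℝ (⊤ : ℕ∞) ρ (Set.Ioo (-2 : ℝ) 0)
  ρ_cont : ContinuousOn ρ (Set.Ioc (-2 : ℝ) 0)
  ρ_zero : ρ 0 = 2
  ρ_one : ∀ q ∈ Set.Ioo (-2 : ℝ) (-1 : ℝ), ρ q = 1

namespace Dumbbell

variable {m : ℕ} (d : Dumbbell m)

def Q1 (ε : ℝ) : Set (ESp (m + 2)) :=
  {x | -1 ≤ x 0 ∧ x 0 ≤ -1 + 2 * ε ∧ primeNorm x < ε * d.ρ ((-1 - x 0) / ε)}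

def Q2 (ε : ℝ) : Set (ESp (m + 2)) :=
  {x | 1 - 2 * ε ≤ x 0 ∧ x 0 ≤ 1 ∧ primeNorm x < ε * d.ρ ((x 0 - 1) / ε)}

def Lε (_d : Dumbbell m) (ε : ℝ) : Set (ESp (m + 2)) :=
  {x | -1 + 2 * ε ≤ x 0 ∧ x 0 ≤ 1 - 2 * ε ∧ primeNorm x < ε}

/-- The connector `Q_ε`. -/
def Q (ε : ℝ) : Set (ESp (m + 2)) := d.Q1 ε ∪ d.Lε ε ∪ d.Q2 ε

/-- The dumbbell domain `Ω_ε = Ω₁ ∪ Ω₂ ∪ Q_ε`. -/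
def Ωε (ε : ℝ) : Set (ESp (m + 2)) := d.Ω₁ ∪ d.Ω₂ ∪ d.Q ε

end Dumbbell

/-- The heat kernel `(4πt)^(-n/2) exp(-‖z‖²/4t)` of Euclidean space. -/
def heatKer {n : ℕ} (t : ℝ) (z : ESp n) : ℝ :=
  (4 * Real.pi * t) ^ (-(n : ℝ) / 2) * Real.exp (-‖z‖ ^ 2 / (4 * t))

/-- The caloric extension of `φ`. -/
def heatExt {n : ℕ} (φ : ESp n → ℝ) (t : ℝ) (x : ESp n) : ℝ :=
  ∫ y, heatKer t (x - y) * φ y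

section HeatKernel

variable {n : ℕ}

lemma heatKer_pos {t : ℝ} (ht : 0 < t) (z : ESp n) : 0 < heatKer t z := by
  have := Real.pi_pos
  unfold heatKer
  positivity

lemma heatKer_le {t : ℝ} (ht : 0 < t) (z : ESp n) :
    heatKer t z ≤ (4 * Real.pi * t) ^ (-(n : ℝ) / 2) := by
  have := Real.pi_pos
  refine mul_le_of_le_one_right (by positivity) (Real.exp_le_one_iff.2 ?_)
  exact div_nonpos_of_nonpos_of_nonneg (by simp) (by positivity)

lemma continuousOn_heatKer :
    ContinuousOn (fun p : ℝ × ESp n => heatKer p.1 p.2) (Ioi 0 ×ˢ univ) := by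
  have hpi := Real.pi_pos
  unfold heatKer
  refine ContinuousOn.mul ?_ ?_
  · refine ContinuousOn.rpow_const (by fun_prop) fun p hp => Or.inl ?_
    have : 0 < p.1 := hp.1
    positivity
  · refine Real.continuous_exp.comp_continuousOn (ContinuousOn.div (by fun_prop) (by fun_prop) ?_)
    intro p hp
    have : 0 < p.1 := hp.1
    positivity

lemma continuous_heatKer (t : ℝ) : Continuous (heatKer t : ESp n → ℝ) := by
  unfold heatKer
  fun_prop

lemma integral_heatKer {t : ℝ} (ht : 0 < t) : ∫ z : ESp n, heatKer t z = 1 := by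
  have hpi := Real.pi_pos
  have h := GaussianFourier.integral_rexp_neg_mul_sq_norm (V := ESp n)
    (b := 1 / (4 * t)) (by positivity)
  have h' : ∀ z : ESp n, heatKer t z
      = (4 * Real.pi * t) ^ (-(n : ℝ) / 2) * Real.exp (-(1 / (4 * t)) * ‖z‖ ^ 2) := by
    intro z
    unfold heatKer
    congr 2
    ring
  simp_rw [h']
  rw [integral_const_mul, h, show Real.pi / (1 / (4 * t)) = 4 * Real.pi * t by field_simp,
    finrank_euclideanSpace_fin, ← Real.rpow_add (by positivity)]
  ring_nf
  simp

lemma integrable_heatKer {t : ℝ} (ht : 0 < t) : Integrable (heatKer t : ESp n → ℝ) := by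
  by_contra h
  have := integral_heatKer (n := n) ht
  rw [integral_undef h] at this
  exact zero_ne_one this

lemma sq_norm_mul_heatKer_le {t : ℝ} (ht : 0 < t) (z : ESp n) :
    ‖z‖ ^ 2 * heatKer t z ≤ 8 * t * 2 ^ ((n : ℝ) / 2) * heatKer (2 * t) z := by
  have hpi := Real.pi_pos
  have hpow : (2 : ℝ) ^ ((n : ℝ) / 2) * (4 * Real.pi * (2 * t)) ^ (-(n : ℝ) / 2)
      = (4 * Real.pi * t) ^ (-(n : ℝ) / 2) := by
    rw [show 4 * Real.pi * (2 * t) = 2 * (4 * Real.pi * t) by ring,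
      Real.mul_rpow (by norm_num) (by positivity), ← mul_assoc, ← Real.rpow_add (by norm_num)]
    ring_nf
    simp
  set c := (4 * Real.pi * t) ^ (-(n : ℝ) / 2) with hc
  have hcpos : 0 < c := by positivity
  set u := ‖z‖ ^ 2 / (8 * t) with hu
  have hz : ‖z‖ ^ 2 = 8 * t * u := by rw [hu]; field_simp
  have h1 : heatKer t z = c * (Real.exp (-u) * Real.exp (-u)) := by
    rw [← Real.exp_add]
    unfold heatKer
    congr 2
    rw [hu]; field_simp; ring
  have h2 : 2 ^ ((n : ℝ) / 2) * heatKer (2 * t) z = c * Real.exp (-u) := by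
    unfold heatKer
    rw [← mul_assoc, hpow]
    congr 2
    rw [hu]; field_simp; ring
  have h3 : u * Real.exp (-u) ≤ 1 := by
    rw [Real.exp_neg, ← div_eq_mul_inv, div_le_one (Real.exp_pos _)]
    linarith [Real.add_one_le_exp u]
  rw [mul_assoc (8 * t), h2, h1, hz]
  have : 0 ≤ 8 * t * (c * Real.exp (-u)) := by positivity
  nlinarith [mul_le_mul_of_nonneg_left h3 this]

lemma hasDerivAt_heatKer_time {t : ℝ} (ht : 0 < t) (z : ESp n) :
    HasDerivAt (fun s => heatKer s z)
      ((‖z‖ ^ 2 / (4 * t ^ 2) - n / (2 * t)) * heatKer t z) t := by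
  have hpi := Real.pi_pos
  have h1 : HasDerivAt (fun s : ℝ => 4 * Real.pi * s) (4 * Real.pi) t := by
    simpa using (hasDerivAt_id t).const_mul (4 * Real.pi)
  have h2 := h1.rpow_const (p := -(n : ℝ) / 2) (Or.inl (by positivity))
  have h3 : HasDerivAt (fun s : ℝ => -‖z‖ ^ 2 / (4 * s)) (‖z‖ ^ 2 / (4 * t ^ 2)) t := by
    have h4 : HasDerivAt (fun s : ℝ => 4 * s) 4 t := by
      simpa using (hasDerivAt_id t).const_mul (4 : ℝ)
    refine ((hasDerivAt_const t (-‖z‖ ^ 2)).div h4 (by positivity)).congr_deriv ?_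
    field_simp; ring
  refine (h2.mul h3.exp).congr_deriv ?_
  rw [Real.rpow_sub_one (by positivity)]
  unfold heatKer
  field_simp
  ring

lemma sq_norm_add_smul_single (z : ESp n) (i : Fin n) (s : ℝ) :
    ‖z + s • (EuclideanSpace.single i 1 : ESp n)‖ ^ 2 = ‖z‖ ^ 2 + 2 * s * z i + s ^ 2 := by
  rw [norm_add_sq_real, inner_smul_right, EuclideanSpace.inner_single_right, norm_smul]
  simp
  ring

lemma hasDerivAt_heatKer_line {t : ℝ} (ht : 0 < t) (z : ESp n) (i : Fin n) (s : ℝ) :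
    HasDerivAt (fun s : ℝ => heatKer t (z + s • (EuclideanSpace.single i 1 : ESp n)))
      (-(z i + s) / (2 * t) * heatKer t (z + s • (EuclideanSpace.single i 1 : ESp n))) s := by
  unfold heatKer
  simp_rw [sq_norm_add_smul_single]
  have h : HasDerivAt (fun s : ℝ => -(‖z‖ ^ 2 + 2 * s * z i + s ^ 2) / (4 * t))
      (-(z i + s) / (2 * t)) s := by
    have h1 : HasDerivAt (fun s : ℝ => 2 * s * z i) (2 * z i) s := by
      simpa using ((hasDerivAt_id s).const_mul (2 : ℝ)).mul_const (z i)
    have h2 : HasDerivAt (fun s : ℝ => s ^ 2) (2 * s) s := by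
      simpa using hasDerivAt_pow 2 s
    refine ((((h1.const_add (‖z‖ ^ 2)).add h2).neg).div_const (4 * t)).congr_deriv ?_
    field_simp; ring
  refine (h.exp.const_mul _).congr_deriv ?_
  ring

lemma hasDerivAt_deriv_heatKer_line {t : ℝ} (ht : 0 < t) (z : ESp n) (i : Fin n) (s : ℝ) :
    HasDerivAt (fun s : ℝ => -(z i + s) / (2 * t) *
        heatKer t (z + s • (EuclideanSpace.single i 1 : ESp n)))
      (((z i + s) ^ 2 / (4 * t ^ 2) - 1 / (2 * t)) *
        heatKer t (z + s • (EuclideanSpace.single i 1 : ESp n))) s := by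
  have h : HasDerivAt (fun s : ℝ => -(z i + s) / (2 * t)) (-1 / (2 * t)) s := by
    simpa using (((hasDerivAt_id s).const_add (z i)).neg).div_const (2 * t)
  refine (h.mul (hasDerivAt_heatKer_line ht z i s)).congr_deriv ?_
  field_simp
  ring

end HeatKernel

section HeatExtension

variable {n : ℕ} {φ : ESp n → ℝ}

lemma hasDerivAt_integral_mul_of_hasCompactSupport {k k' : ℝ → ESp n → ℝ}
    (hφ : Continuous φ) (hc : HasCompactSupport φ) {S : Set ℝ} (hS : IsOpen S)
    (hk : ∀ s ∈ S, Continuous (k s))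
    (hk' : ContinuousOn (Function.uncurry k') (S ×ˢ univ))
    (hd : ∀ s ∈ S, ∀ y, HasDerivAt (k · y) (k' s y) s) {s₀ : ℝ} (hs₀ : s₀ ∈ S) :
    HasDerivAt (fun s => ∫ y, k s y * φ y) (∫ y, k' s₀ y * φ y) s₀ := by
  obtain ⟨r, hr, hrS⟩ := Metric.nhds_basis_closedBall.mem_iff.1 (hS.mem_nhds hs₀)
  have hcomp : IsCompact (closedBall s₀ r ×ˢ tsupport φ) :=
    (isCompact_closedBall s₀ r).prod hc
  obtain ⟨C, hC⟩ := hcomp.exists_bound_of_continuousOn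
    (hk'.mono (prod_mono hrS (subset_univ _)))
  have hk'₀ : Continuous (k' s₀) := by
    have := hk'.comp (f := fun y : ESp n => (s₀, y)) (s := univ) (by fun_prop)
      (fun y _ => ⟨hs₀, mem_univ _⟩)
    exact continuousOn_univ.1 this
  refine (hasDerivAt_integral_of_dominated_loc_of_deriv_le (μ := volume)
    (F := fun s y => k s y * φ y) (F' := fun s y => k' s y * φ y)
    (bound := fun y => C * |φ y|) (Metric.closedBall_mem_nhds s₀ hr) ?_ ?_ ?_ ?_ ?_ ?_).2
  · filter_upwards [hS.mem_nhds hs₀] with s hs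
    exact ((hk s hs).mul hφ).aestronglyMeasurable
  · exact ((hk s₀ hs₀).mul hφ).integrable_of_hasCompactSupport hc.mul_left
  · exact (hk'₀.mul hφ).aestronglyMeasurable
  · refine Eventually.of_forall fun y s hs => ?_
    by_cases hy : y ∈ tsupport φ
    · rw [norm_mul]
      exact mul_le_mul_of_nonneg_right (hC (s, y) ⟨hs, hy⟩) (abs_nonneg _)
    · simp [image_eq_zero_of_notMem_tsupport hy]
  · exact (hφ.integrable_of_hasCompactSupport hc).abs.const_mul C
  · exact Eventually.of_forall fun y s hs => (hd s (hrS hs) y).mul_const (φ y)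

lemma IsLocalMax.second_deriv_nonpos {g g' : ℝ → ℝ} {a b : ℝ} (hmax : IsLocalMax g a)
    (hg : ∀ᶠ s in nhds a, HasDerivAt g (g' s) s) (hg' : HasDerivAt g' b a) : b ≤ 0 := by
  by_contra! hb
  have hder : deriv g =ᶠ[nhds a] g' := hg.mono fun s hs => hs.deriv
  have hdd : deriv (deriv g) a = b := by rw [hder.deriv_eq, hg'.deriv]
  have hmin := isLocalMin_of_deriv_deriv_pos (by rw [hdd]; exact hb) hmax.deriv_eq_zero
    hg.self_of_nhds.continuousAt
  have hconst : g =ᶠ[nhds a] fun _ => g a := by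
    filter_upwards [hmax, hmin] with s h1 h2 using le_antisymm h1 h2
  have hzero : deriv (deriv g) a = 0 := by
    rw [hconst.deriv.deriv_eq]
    simp
  linarith

lemma integrable_heatKer_sub_mul (hφ : Continuous φ) (hc : HasCompactSupport φ) (t : ℝ)
    (x : ESp n) : Integrable fun y => heatKer t (x - y) * φ y :=
  (((continuous_heatKer t).comp (by fun_prop)).mul hφ).integrable_of_hasCompactSupport hc.mul_left

lemma heatExt_nonneg (hφ : ∀ x, 0 ≤ φ x) {t : ℝ} (ht : 0 < t) (x : ESp n) :
    0 ≤ heatExt φ t x :=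
  integral_nonneg fun y => mul_nonneg (heatKer_pos ht _).le (hφ y)

lemma exists_modulus (hφ : Continuous φ) (hc : HasCompactSupport φ) {δ : ℝ} (hδ : 0 < δ) :
    ∃ M, 0 ≤ M ∧ ∀ x y, |φ x - φ y| ≤ δ + M * ‖x - y‖ ^ 2 := by
  obtain ⟨B, hB⟩ := hc.exists_bound_of_continuous hφ
  have hB0 : 0 ≤ B := (norm_nonneg _).trans (hB 0)
  obtain ⟨r, hr, hu⟩ := Metric.uniformContinuous_iff.1
    (hφ.uniformContinuous_of_tendsto_cocompact hc.is_zero_at_infty) δ hδ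
  refine ⟨2 * B / r ^ 2, by positivity, fun x y => ?_⟩
  rcases lt_or_ge (dist x y) r with h | h
  · have := (hu h).le
    rw [Real.dist_eq] at this
    have : 0 ≤ 2 * B / r ^ 2 * ‖x - y‖ ^ 2 := by positivity
    linarith
  · rw [dist_eq_norm] at h
    have h1 : |φ x - φ y| ≤ 2 * B := by
      have := norm_sub_le (φ x) (φ y)
      rw [Real.norm_eq_abs] at this
      linarith [hB x, hB y]
    have h2 : 2 * B ≤ 2 * B / r ^ 2 * ‖x - y‖ ^ 2 := by
      rw [div_mul_eq_mul_div, le_div_iff₀ (by positivity)]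
      gcongr
    linarith

lemma abs_heatExt_sub_le (hφ : Continuous φ) (hc : HasCompactSupport φ) {δ M : ℝ}
    (hM : 0 ≤ M) (h : ∀ x y, |φ x - φ y| ≤ δ + M * ‖x - y‖ ^ 2)
    {t : ℝ} (ht : 0 < t) (x : ESp n) :
    |heatExt φ t x - φ x| ≤ δ + M * (8 * 2 ^ ((n : ℝ) / 2)) * t := by
  have hone : ∀ {s : ℝ}, 0 < s → ∫ y, heatKer s (x - y) = 1 := fun hs => by
    rw [integral_sub_left_eq_self (heatKer _) volume x, integral_heatKer hs]
  have hint : ∀ {s : ℝ}, 0 < s → Integrable fun y => heatKer s (x - y) :=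
    fun hs => (integrable_heatKer hs).comp_sub_left x
  have heq : heatExt φ t x - φ x = ∫ y, heatKer t (x - y) * (φ y - φ x) := by
    simp_rw [mul_sub]
    rw [integral_sub (integrable_heatKer_sub_mul hφ hc t x) ((hint ht).mul_const _),
      integral_mul_const, hone ht, one_mul, heatExt]
  rw [heq, ← Real.norm_eq_abs]
  refine (norm_integral_le_of_norm_le (g := fun y => δ * heatKer t (x - y) +
    M * (8 * t * 2 ^ ((n : ℝ) / 2)) * heatKer (2 * t) (x - y)) ?_ ?_).trans ?_
  · exact ((hint ht).const_mul _).add ((hint (by positivity)).const_mul _)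
  · refine Eventually.of_forall fun y => ?_
    have hp := heatKer_pos ht (x - y)
    rw [norm_mul, Real.norm_of_nonneg hp.le, Real.norm_eq_abs, abs_sub_comm]
    have h1 := mul_le_mul_of_nonneg_left (h x y) hp.le
    have h2 := mul_le_mul_of_nonneg_left (sq_norm_mul_heatKer_le ht (x - y)) hM
    linarith
  · rw [integral_add ((hint ht).const_mul _) ((hint (by positivity)).const_mul _),
      integral_const_mul, integral_const_mul, hone ht, hone (by positivity)]
    apply le_of_eq
    ring

lemma continuousOn_heatExt (hφ : Continuous φ) (hc : HasCompactSupport φ) :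
    ContinuousOn (fun p : ℝ × ESp n => heatExt φ p.1 p.2) (Ioi 0 ×ˢ univ) := by
  unfold heatExt
  refine continuousOn_integral_of_compact_support (k := tsupport φ) hc ?_ ?_
  · refine ContinuousOn.mul (f := fun q : (ℝ × ESp n) × ESp n => heatKer q.1.1 (q.1.2 - q.2)) ?_
      (by fun_prop)
    exact continuousOn_heatKer.comp (f := fun q : (ℝ × ESp n) × ESp n => (q.1.1, q.1.2 - q.2))
      (by fun_prop) fun q hq => ⟨hq.1.1, mem_univ _⟩
  · intro p y _ hy
    simp [image_eq_zero_of_notMem_tsupport hy]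

lemma hasDerivAt_heatExt_time (hφ : Continuous φ) (hc : HasCompactSupport φ) {t : ℝ}
    (ht : 0 < t) (x : ESp n) :
    HasDerivAt (fun s => heatExt φ s x)
      (∫ y, ((‖x - y‖ ^ 2 / (4 * t ^ 2) - n / (2 * t)) * heatKer t (x - y)) * φ y) t := by
  refine hasDerivAt_integral_mul_of_hasCompactSupport (k := fun s y => heatKer s (x - y))
    (k' := fun s y => (‖x - y‖ ^ 2 / (4 * s ^ 2) - n / (2 * s)) * heatKer s (x - y))
    hφ hc isOpen_Ioi ?_ ?_ ?_ (mem_Ioi.2 ht)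
  · exact fun s _ => (continuous_heatKer s).comp (by fun_prop)
  · refine ContinuousOn.mul (f := fun q : ℝ × ESp n =>
      ‖x - q.2‖ ^ 2 / (4 * q.1 ^ 2) - n / (2 * q.1)) ?_ ?_
    · refine ContinuousOn.sub (ContinuousOn.div (by fun_prop) (by fun_prop) ?_)
        (ContinuousOn.div (by fun_prop) (by fun_prop) ?_) <;>
      · intro q hq
        have : 0 < q.1 := hq.1
        positivity
    · exact continuousOn_heatKer.comp (f := fun q : ℝ × ESp n => (q.1, x - q.2))
        (by fun_prop) fun q hq => ⟨hq.1, mem_univ _⟩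
  · exact fun s hs y => hasDerivAt_heatKer_time hs _

lemma hasDerivAt_heatExt_line (hφ : Continuous φ) (hc : HasCompactSupport φ) {t : ℝ}
    (ht : 0 < t) (x : ESp n) (i : Fin n) (s : ℝ) :
    HasDerivAt (fun s : ℝ => heatExt φ t (x + s • (EuclideanSpace.single i 1 : ESp n)))
      (∫ y, (-((x - y) i + s) / (2 * t) *
        heatKer t (x - y + s • (EuclideanSpace.single i 1 : ESp n))) * φ y) s := by
  unfold heatExt
  simp_rw [add_sub_right_comm]
  refine hasDerivAt_integral_mul_of_hasCompactSupport
    (k := fun s y => heatKer t (x - y + s • (EuclideanSpace.single i 1 : ESp n)))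
    (k' := fun s y => -((x - y) i + s) / (2 * t) *
      heatKer t (x - y + s • (EuclideanSpace.single i 1 : ESp n)))
    hφ hc isOpen_univ ?_ ?_ ?_ (mem_univ s)
  · exact fun s _ => (continuous_heatKer t).comp (by fun_prop)
  · refine Continuous.continuousOn (Continuous.mul (f := fun q : ℝ × ESp n =>
      -((x - q.2) i + q.1) / (2 * t)) (by fun_prop) ?_)
    exact (continuous_heatKer t).comp (by fun_prop)
  · exact fun s _ y => hasDerivAt_heatKer_line ht _ i s

lemma hasDerivAt_deriv_heatExt_line (hφ : Continuous φ) (hc : HasCompactSupport φ) {t : ℝ}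
    (ht : 0 < t) (x : ESp n) (i : Fin n) :
    HasDerivAt (fun s : ℝ => ∫ y, (-((x - y) i + s) / (2 * t) *
        heatKer t (x - y + s • (EuclideanSpace.single i 1 : ESp n))) * φ y)
      (∫ y, (((x - y) i ^ 2 / (4 * t ^ 2) - 1 / (2 * t)) * heatKer t (x - y)) * φ y) 0 := by
  have h := hasDerivAt_integral_mul_of_hasCompactSupport
    (k := fun s y => -((x - y) i + s) / (2 * t) *
      heatKer t (x - y + s • (EuclideanSpace.single i 1 : ESp n)))
    (k' := fun s y => (((x - y) i + s) ^ 2 / (4 * t ^ 2) - 1 / (2 * t)) *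
      heatKer t (x - y + s • (EuclideanSpace.single i 1 : ESp n)))
    hφ hc isOpen_univ ?_ ?_ ?_ (mem_univ 0)
  · simpa only [add_zero, zero_smul] using h
  · intro s _
    exact Continuous.mul (by fun_prop) ((continuous_heatKer t).comp (by fun_prop))
  · refine Continuous.continuousOn (Continuous.mul (f := fun q : ℝ × ESp n =>
      ((x - q.2) i + q.1) ^ 2 / (4 * t ^ 2) - 1 / (2 * t)) (by fun_prop) ?_)
    exact (continuous_heatKer t).comp (by fun_prop)
  · exact fun s _ y => hasDerivAt_deriv_heatKer_line ht _ i s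

lemma sum_integral_second_deriv_heatKer (hφ : Continuous φ) (hc : HasCompactSupport φ) (t : ℝ)
    (x : ESp n) :
    ∑ i, ∫ y, (((x - y) i ^ 2 / (4 * t ^ 2) - 1 / (2 * t)) * heatKer t (x - y)) * φ y
      = ∫ y, ((‖x - y‖ ^ 2 / (4 * t ^ 2) - n / (2 * t)) * heatKer t (x - y)) * φ y := by
  rw [← integral_finsetSum]
  · congr 1 with y
    rw [← Finset.sum_mul, ← Finset.sum_mul, Finset.sum_sub_distrib, ← Finset.sum_div,
      EuclideanSpace.real_norm_sq_eq]
    simp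
    left; left
    ring
  · intro i _
    refine Continuous.integrable_of_hasCompactSupport ?_ hc.mul_left
    exact (Continuous.mul (by fun_prop) ((continuous_heatKer t).comp (by fun_prop))).mul hφ

end HeatExtension

section Comparison

variable {n : ℕ} {φ : ESp n → ℝ} {U : Set (ESp n)}

lemma hasCompactSupport_of_isBounded (hU : Bornology.IsBounded U) (h : ∀ x, x ∉ U → φ x = 0) :
    HasCompactSupport φ :=
  HasCompactSupport.intro hU.isCompact_closure fun x hx => h x fun hxU => hx (subset_closure hxU)

/-- A nonnegative function vanishing outside a bounded open set `U` and solving `Δφ = -lam φ` in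
`U` is dominated by `exp(Λ T)` times its caloric extension, for every `Λ > lam`. -/
lemma exp_mul_le_heatExt (hUo : IsOpen U) (hUb : Bornology.IsBounded U) (hφ : Continuous φ)
    (hpos : ∀ x, 0 ≤ φ x) (hzero : ∀ x, x ∉ U → φ x = 0) (hC2 : ContDiffOn ℝ 2 φ U)
    {lam Λ : ℝ} (hlap : ∀ x ∈ U, lap φ x + lam * φ x = 0) (hΛ : lam < Λ) (hΛ0 : 0 ≤ Λ)
    {T : ℝ} (hT : 0 < T) (x : ESp n) :
    Real.exp (-Λ * T) * φ x ≤ heatExt φ T x := by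
  have hc : HasCompactSupport φ := hasCompactSupport_of_isBounded hUb hzero
  refine le_of_forall_pos_le_add fun δ hδ => ?_
  by_contra! hlt
  obtain ⟨M, hM, hmod⟩ := exists_modulus hφ hc (half_pos hδ)
  set A := M * (8 * 2 ^ ((n : ℝ) / 2)) with hA
  have hA0 : 0 ≤ A := by positivity
  obtain ⟨τ, hτ, hτT, hAτ⟩ : ∃ τ, 0 < τ ∧ τ ≤ T ∧ A * τ ≤ δ / 2 := by
    refine ⟨min T (δ / 2 / (A + 1)), by positivity, min_le_left _ _, ?_⟩
    have h1 : A * min T (δ / 2 / (A + 1)) ≤ (A + 1) * (δ / 2 / (A + 1)) :=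
      mul_le_mul (by linarith) (min_le_right _ _) (by positivity) (by positivity)
    rwa [mul_div_cancel₀ _ (by positivity)] at h1
  set h : ℝ × ESp n → ℝ := fun p => Real.exp (-Λ * p.1) * φ p.2 - heatExt φ p.1 p.2 with hh
  have hmemU : ∀ {t : ℝ} {z : ESp n}, 0 < t → δ < h (t, z) → z ∈ U := by
    intro t z ht hz
    by_contra hzU
    have := heatExt_nonneg hpos ht z
    simp only [hh, hzero z hzU, mul_zero] at hz
    linarith
  have hcomp : IsCompact (Icc τ T ×ˢ closure U) := isCompact_Icc.prod hUb.isCompact_closure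
  have hTx : δ < h (T, x) := by simp only [hh]; linarith
  have hTmem : (T, x) ∈ Icc τ T ×ˢ closure U :=
    ⟨⟨hτT, le_rfl⟩, subset_closure (hmemU hT hTx)⟩
  have hcont : ContinuousOn h (Icc τ T ×ˢ closure U) := by
    refine ContinuousOn.sub (by fun_prop) ((continuousOn_heatExt hφ hc).mono ?_)
    exact prod_mono (fun t ht => hτ.trans_le ht.1) (subset_univ _)
  obtain ⟨⟨t, z⟩, ⟨⟨htτ, htT⟩, -⟩, hmax⟩ := hcomp.exists_isMaxOn ⟨_, hTmem⟩ hcont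
  simp only at htτ htT
  have hδh : δ < h (t, z) := hTx.trans_le (hmax hTmem)
  have ht : 0 < t := hτ.trans_le htτ
  have hzU : z ∈ U := hmemU ht hδh
  have hφz : 0 < φ z := by
    refine (hpos z).lt_of_ne' fun h0 => ?_
    have := heatExt_nonneg hpos ht z
    simp only [hh, h0, mul_zero] at hδh
    linarith
  have hτt : τ < t := by
    refine htτ.lt_of_ne fun heq => ?_
    have h1 := (abs_le.1 (abs_heatExt_sub_le hφ hc hM hmod ht z)).1
    rw [← hA, ← heq] at h1
    have h2 : Real.exp (-Λ * τ) * φ z ≤ φ z :=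
      mul_le_of_le_one_left hφz.le (Real.exp_le_one_iff.2 (by nlinarith))
    rw [← heq] at hδh
    simp only [hh] at hδh
    linarith
  set D := ∫ y, ((‖z - y‖ ^ 2 / (4 * t ^ 2) - n / (2 * t)) * heatKer t (z - y)) * φ y with hD
  have htime : 0 ≤ -Λ * Real.exp (-Λ * t) * φ z - D := by
    have hd : HasDerivAt (fun s => h (s, z)) (-Λ * Real.exp (-Λ * t) * φ z - D) t := by
      refine HasDerivAt.sub ?_ (hasDerivAt_heatExt_time hφ hc ht z)
      have h1 : HasDerivAt (fun s : ℝ => -Λ * s) (-Λ) t := by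
        simpa using (hasDerivAt_id t).const_mul (-Λ)
      refine (h1.exp.mul_const (φ z)).congr_deriv (by ring)
    refine ge_of_tendsto (hd.tendsto_slope.mono_left (nhdsLT_le_nhdsNE t)) ?_
    filter_upwards [Ioo_mem_nhdsLT hτt] with s hs
    have : h (s, z) ≤ h (t, z) :=
      hmax (show (s, z) ∈ Icc τ T ×ˢ closure U from
        ⟨⟨hs.1.le, hs.2.le.trans htT⟩, subset_closure hzU⟩)
    rw [slope_def_field]
    exact div_nonneg_of_nonpos (by linarith) (by linarith [hs.2])
  have hspace : ∀ i : Fin n, Real.exp (-Λ * t) *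
      fderiv ℝ (fun y => fderiv ℝ φ y (EuclideanSpace.single i 1)) z (EuclideanSpace.single i 1)
      - ∫ y, (((z - y) i ^ 2 / (4 * t ^ 2) - 1 / (2 * t)) * heatKer t (z - y)) * φ y ≤ 0 := by
    intro i
    set e : ESp n := EuclideanSpace.single i 1 with he
    have hline : ∀ s : ℝ, HasDerivAt (fun s : ℝ => z + s • e) e s := fun s => by
      simpa using ((hasDerivAt_id s).smul_const e).const_add z
    have hUline : ∀ᶠ s : ℝ in nhds 0, z + s • e ∈ U := by
      have : ContinuousAt (fun s : ℝ => z + s • e) 0 := (hline 0).continuousAt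
      exact this.preimage_mem_nhds (hUo.mem_nhds (by simpa using hzU))
    refine IsLocalMax.second_deriv_nonpos (g := fun s : ℝ => h (t, z + s • e)) (a := 0)
      (g' := fun s => Real.exp (-Λ * t) * fderiv ℝ φ (z + s • e) e -
        ∫ y, (-((z - y) i + s) / (2 * t) * heatKer t (z - y + s • e)) * φ y) ?_ ?_ ?_
    · filter_upwards [hUline] with s hs
      rw [zero_smul, add_zero]
      exact hmax (show (t, z + s • e) ∈ Icc τ T ×ˢ closure U from
        ⟨⟨htτ, htT⟩, subset_closure hs⟩)
    · filter_upwards [hUline] with s hs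
      have hdiff : DifferentiableAt ℝ φ (z + s • e) :=
        (hC2.contDiffAt (hUo.mem_nhds hs)).differentiableAt (by norm_num)
      have hd := hdiff.hasFDerivAt.comp_hasDerivAt s (hline s)
      exact (hd.const_mul (Real.exp (-Λ * t))).sub (hasDerivAt_heatExt_line hφ hc ht z i s)
    · refine HasDerivAt.sub (HasDerivAt.const_mul _ ?_) (hasDerivAt_deriv_heatExt_line hφ hc ht z i)
      have hdiff : DifferentiableAt ℝ (fun y => fderiv ℝ φ y e) z := by
        have h1 : ContDiffAt ℝ 1 (fderiv ℝ φ) z :=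
          (hC2.contDiffAt (hUo.mem_nhds hzU)).fderiv_right (by norm_num)
        exact (h1.differentiableAt (by norm_num)).clm_apply (differentiableAt_const e)
      have hdiff' : HasFDerivAt (fun y => fderiv ℝ φ y e)
          (fderiv ℝ (fun y => fderiv ℝ φ y e) z) (z + (0 : ℝ) • e) := by
        simpa using hdiff.hasFDerivAt
      exact hdiff'.comp_hasDerivAt (0 : ℝ) (hline 0)
  have hsum := Finset.sum_nonpos fun i (_ : i ∈ Finset.univ) => hspace i
  rw [Finset.sum_sub_distrib, ← Finset.mul_sum, sum_integral_second_deriv_heatKer hφ hc,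
    ← hD] at hsum
  change Real.exp (-Λ * t) * lap φ z - D ≤ 0 at hsum
  have hl : lap φ z = -lam * φ z := by linarith [hlap z hzU]
  rw [hl] at hsum
  have : 0 < (Λ - lam) * (Real.exp (-Λ * t) * φ z) :=
    mul_pos (by linarith) (mul_pos (Real.exp_pos _) hφz)
  nlinarith

end Comparison

section FirstEigenfunction

variable {n : ℕ} {φ : ESp n → ℝ} {U : Set (ESp n)}

lemma IsFirstDirEigenfun.isOpen (h : IsFirstDirEigenfun U φ) (hpos : ∀ x ∈ U, 0 < φ x) :
    IsOpen U := by
  rw [← disjoint_frontier_iff_isOpen, Set.disjoint_left]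
  exact fun x hx hxU => (hpos x hxU).ne' (h.2.2.2.2 x hx)

lemma IsFirstDirEigenfun.continuous (h : IsFirstDirEigenfun U φ)
    (hzero : ∀ x, x ∉ U → φ x = 0) : Continuous φ := by
  have h1 : ContinuousOn φ (closure Uᶜ) := by
    refine (continuousOn_const (c := (0 : ℝ))).congr fun x hx => ?_
    by_cases hxU : x ∈ U
    · refine h.2.2.2.2 x ?_
      rw [frontier_eq_closure_inter_closure]
      exact ⟨subset_closure hxU, hx⟩
    · exact hzero x hxU
  have h2 := h.2.2.1.union_of_isClosed h1 isClosed_closure isClosed_closure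
  rw [← closure_union, union_compl_self, closure_univ] at h2
  exact continuousOn_univ.1 h2

end FirstEigenfunction

lemma heatExt_sub_le {n : ℕ} {f g : ESp n → ℝ} (hf : Continuous f) (hfc : HasCompactSupport f)
    (hg : Continuous g) (hgc : HasCompactSupport g) {t κ : ℝ} (ht : 0 < t) (hκ : 0 < κ)
    (x : ESp n) :
    heatExt f t x - heatExt g t x ≤
      κ * (4 * Real.pi * t) ^ (-(n : ℝ) / 2) + κ⁻¹ * ∫ y, (f y - g y) ^ 2 := by
  have hi : Integrable fun y => heatKer t (x - y) := (integrable_heatKer ht).comp_sub_left x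
  have hsq : Integrable fun y => (f y - g y) ^ 2 := by
    refine Continuous.integrable_of_hasCompactSupport (by fun_prop) ?_
    exact (hfc.sub hgc).comp_left (g := fun r : ℝ => r ^ 2) (by norm_num)
  set c := (4 * Real.pi * t) ^ (-(n : ℝ) / 2)
  have hone : ∫ y, heatKer t (x - y) = 1 := by
    rw [integral_sub_left_eq_self (heatKer _) volume x, integral_heatKer ht]
  unfold heatExt
  rw [← integral_sub (integrable_heatKer_sub_mul hf hfc t x)
    (integrable_heatKer_sub_mul hg hgc t x)]
  calc ∫ y, (heatKer t (x - y) * f y - heatKer t (x - y) * g y)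
      ≤ ∫ y, (κ * c * heatKer t (x - y) + κ⁻¹ * (f y - g y) ^ 2) := by
        refine integral_mono ((integrable_heatKer_sub_mul hf hfc t x).sub
          (integrable_heatKer_sub_mul hg hgc t x)) ((hi.const_mul _).add (hsq.const_mul _)) ?_
        intro y
        have hp := heatKer_pos ht (x - y)
        have hle : heatKer t (x - y) * heatKer t (x - y) ≤ c * heatKer t (x - y) :=
          mul_le_mul_of_nonneg_right (heatKer_le ht _) hp.le
        have h1 := mul_le_mul_of_nonneg_left hle hκ.le
        have h2 : 0 ≤ κ⁻¹ * ((κ * heatKer t (x - y) - (f y - g y)) ^ 2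
            + (κ * heatKer t (x - y)) ^ 2 + (f y - g y) ^ 2) := by positivity
        have h3 : κ⁻¹ * ((κ * heatKer t (x - y) - (f y - g y)) ^ 2
            + (κ * heatKer t (x - y)) ^ 2 + (f y - g y) ^ 2)
            = 2 * (κ * (heatKer t (x - y) * heatKer t (x - y)))
              - 2 * (heatKer t (x - y) * (f y - g y)) + 2 * (κ⁻¹ * (f y - g y) ^ 2) := by
          field_simp
          ring
        simp only
        linarith
    _ = κ * c + κ⁻¹ * ∫ y, (f y - g y) ^ 2 := by
        rw [integral_add (hi.const_mul _) (hsq.const_mul _), integral_const_mul,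
          integral_const_mul, hone, mul_one]

namespace Dumbbell

variable {m : ℕ} (d : Dumbbell m)

lemma exists_ρ_le : ∃ B, ∀ q ∈ Icc (-2 : ℝ) 0, d.ρ q ≤ B := by
  obtain ⟨C, hC⟩ := (isCompact_Icc (a := (-1 : ℝ)) (b := 0)).exists_bound_of_continuousOn
    (d.ρ_cont.mono fun q hq => ⟨by linarith [hq.1], hq.2⟩)
  refine ⟨max (max C 1) (d.ρ (-2)), fun q hq => ?_⟩
  rcases eq_or_lt_of_le hq.1 with h | h
  · exact h ▸ le_max_right _ _
  · refine le_max_of_le_left ?_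
    rcases lt_or_ge q (-1) with h' | h'
    · exact (d.ρ_one q ⟨h, h'⟩).le.trans (le_max_right _ _)
    · exact (le_abs_self _).trans ((hC q ⟨h', hq.2⟩).trans (le_max_left _ _))

lemma isBounded_of_primeNorm_le {S : Set (ESp (m + 2))} {a b : ℝ}
    (h : ∀ x ∈ S, |x 0| ≤ a ∧ primeNorm x ≤ b) : Bornology.IsBounded S := by
  refine (Metric.isBounded_closedBall (x := 0) (r := a + b)).subset fun x hx => ?_
  obtain ⟨h1, h2⟩ := h x hx
  have hb : 0 ≤ primeNorm x := Real.sqrt_nonneg _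
  have hsq : primeNorm x ^ 2 = ∑ i : Fin (m + 1), x i.succ ^ 2 :=
    Real.sq_sqrt (Finset.sum_nonneg fun i _ => sq_nonneg _)
  rw [mem_closedBall_zero_iff]
  have hn : ‖x‖ ^ 2 = |x 0| ^ 2 + primeNorm x ^ 2 := by
    rw [EuclideanSpace.real_norm_sq_eq, Fin.sum_univ_succ, hsq, sq_abs]
  refine (abs_le_of_sq_le_sq' ?_ (by linarith [abs_nonneg (x 0)])).2
  nlinarith [abs_nonneg (x 0)]

lemma isBounded_Ωε {ε : ℝ} (hε : 0 < ε) : Bornology.IsBounded (d.Ωε ε) := by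
  obtain ⟨B, hB⟩ := d.exists_ρ_le
  refine (d.bounded₁.union d.bounded₂).union
    (Bornology.IsBounded.union (Bornology.IsBounded.union ?_ ?_) ?_)
  · refine isBounded_of_primeNorm_le (a := 1 + 2 * ε) (b := ε * B) ?_
    rintro x ⟨h1, h2, h3⟩
    refine ⟨abs_le.2 ⟨by linarith, by linarith⟩, h3.le.trans ?_⟩
    refine mul_le_mul_of_nonneg_left (hB _ ⟨?_, ?_⟩) hε.le
    · rw [le_div_iff₀ hε]; linarith
    · exact div_nonpos_of_nonpos_of_nonneg (by linarith) hε.le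
  · refine isBounded_of_primeNorm_le (a := 1 + 2 * ε) (b := ε) ?_
    rintro x ⟨h1, h2, h3⟩
    exact ⟨abs_le.2 ⟨by linarith, by linarith⟩, h3.le⟩
  · refine isBounded_of_primeNorm_le (a := 1 + 2 * ε) (b := ε * B) ?_
    rintro x ⟨h1, h2, h3⟩
    refine ⟨abs_le.2 ⟨by linarith, by linarith⟩, h3.le.trans ?_⟩
    refine mul_le_mul_of_nonneg_left (hB _ ⟨?_, ?_⟩) hε.le
    · rw [le_div_iff₀ hε]; linarith
    · exact div_nonpos_of_nonpos_of_nonneg (by linarith) hε.le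

end Dumbbell

/-- (Remark 3.2.) Under the same hypotheses as Lemma 3.1, the positive
normalized first Dirichlet eigenfunctions `φ_{1,ε_i}` of `Ω_{ε_i}` (extended by zero)
tend to `0` uniformly on `Ω₂`. -/
theorem stmt3 (m : ℕ) (d : Dumbbell m)
    (hlam : dirEig1 d.Ω₁ < dirEig1 d.Ω₂)
    (ε : ℕ → ℝ) (hεpos : ∀ i, 0 < ε i) (hεanti : StrictAnti ε)
    (hεlim : Tendsto ε atTop (nhds 0))
    (φ : ℕ → ESp (m + 2) → ℝ)
    (hφ : ∀ i, IsFirstDirEigenfun (d.Ωε (ε i)) (φ i))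
    (hφpos : ∀ i, ∀ x ∈ d.Ωε (ε i), 0 < φ i x)
    (hφnorm : ∀ i, (∫ x in d.Ωε (ε i), (φ i x) ^ 2) = 1)
    (hφext : ∀ i, ∀ x, x ∉ d.Ωε (ε i) → φ i x = 0)
    (φ₀ : ESp (m + 2) → ℝ)
    (hφ₀ : IsFirstDirEigenfun d.Ω₁ φ₀)
    (hφ₀pos : ∀ x ∈ d.Ω₁, 0 < φ₀ x)
    (hφ₀norm : (∫ x in d.Ω₁, φ₀ x ^ 2) = 1)
    (hφ₀ext : ∀ x, x ∉ d.Ω₁ → φ₀ x = 0)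
    (heig : Tendsto (fun i => dirEig1 (d.Ωε (ε i))) atTop (nhds (dirEig1 d.Ω₁)))
    (hL2 : Tendsto (fun i => Real.sqrt (∫ x, (φ i x - φ₀ x) ^ 2)) atTop (nhds 0)) :
    Tendsto (fun i => sSup ((fun x => |φ i x|) '' d.Ω₂)) atTop (nhds 0) := by
  have hbdd := fun i => d.isBounded_Ωε (hεpos i)
  have hnonneg : ∀ i x, 0 ≤ φ i x := fun i x => by
    by_cases hx : x ∈ d.Ωε (ε i)
    · exact (hφpos i x hx).le
    · exact (hφext i x hx).ge
  have hcont := fun i => (hφ i).continuous (hφext i)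
  have hcs := fun i => hasCompactSupport_of_isBounded (hbdd i) (hφext i)
  have hcont₀ := hφ₀.continuous hφ₀ext
  have hcs₀ := hasCompactSupport_of_isBounded d.bounded₁ hφ₀ext
  have hint : Tendsto (fun i => ∫ x, (φ i x - φ₀ x) ^ 2) atTop (nhds 0) := by
    have h := hL2.pow 2
    simpa [Real.sq_sqrt (integral_nonneg fun x => sq_nonneg (φ _ x - φ₀ x))] using h
  set Λ := |dirEig1 d.Ω₁| + 1 with hΛ
  have hΛ0 : 0 ≤ Λ := by positivity
  have hev : ∀ᶠ i in atTop, dirEig1 (d.Ωε (ε i)) < Λ :=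
    heig.eventually_lt_const (by rw [hΛ]; linarith [le_abs_self (dirEig1 d.Ω₁)])
  have key : ∀ δ : ℝ, 0 < δ → ∀ᶠ i in atTop, ∀ x ∈ d.Ω₂, φ i x ≤ Real.exp Λ * (4 * δ) := by
    intro δ hδ
    obtain ⟨M, hM, hmod⟩ := exists_modulus hcont₀ hcs₀ hδ
    set A := M * (8 * 2 ^ (((m + 2 : ℕ) : ℝ) / 2)) with hA
    have hA0 : 0 ≤ A := by positivity
    obtain ⟨t, ht, ht1, hAt⟩ : ∃ t, 0 < t ∧ t ≤ 1 ∧ A * t ≤ δ := by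
      refine ⟨min 1 (δ / (A + 1)), by positivity, min_le_left _ _, ?_⟩
      have h1 : A * min 1 (δ / (A + 1)) ≤ (A + 1) * (δ / (A + 1)) :=
        mul_le_mul (by linarith) (min_le_right _ _) (by positivity) (by positivity)
      rwa [mul_div_cancel₀ _ (by positivity)] at h1
    have hpi := Real.pi_pos
    set c := (4 * Real.pi * t) ^ (-((m + 2 : ℕ) : ℝ) / 2) with hc
    have hc0 : 0 < c := by positivity
    have hκ : 0 < δ / c := by positivity
    filter_upwards [hev, hint.eventually_lt_const (show 0 < δ * (δ / c) by positivity)]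
      with i hi hi2 x hx
    have h1 := exp_mul_le_heatExt ((hφ i).isOpen (hφpos i)) (hbdd i) (hcont i) (hnonneg i)
      (hφext i) (hφ i).2.1 (hφ i).2.2.2.1 hi hΛ0 ht x
    have h2 := heatExt_sub_le (hcont i) (hcs i) hcont₀ hcs₀ ht hκ x
    have h3 := (abs_le.1 (abs_heatExt_sub_le hcont₀ hcs₀ hM hmod ht x)).2
    rw [hφ₀ext x (Set.disjoint_right.1 d.disj hx), ← hA] at h3
    rw [← hc, div_mul_cancel₀ _ hc0.ne'] at h2
    have h4 : (δ / c)⁻¹ * ∫ y, (φ i y - φ₀ y) ^ 2 ≤ δ := by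
      rw [inv_mul_le_iff₀ hκ]
      linarith
    have h5 : Real.exp (-Λ) * φ i x ≤ Real.exp (-Λ * t) * φ i x :=
      mul_le_mul_of_nonneg_right (Real.exp_le_exp.2 (by nlinarith)) (hnonneg i x)
    have h6 : Real.exp (-Λ) * φ i x ≤ 4 * δ := by linarith
    rwa [Real.exp_neg, inv_mul_le_iff₀ (Real.exp_pos _)] at h6
  rw [Metric.tendsto_nhds]
  intro η hη
  have hE := Real.exp_pos Λ
  filter_upwards [key (η / (8 * Real.exp Λ)) (by positivity)] with i hi
  have hle : sSup ((fun x => |φ i x|) '' d.Ω₂) ≤ η / 2 := by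
    refine Real.sSup_le ?_ (by positivity)
    rintro _ ⟨x, hx, rfl⟩
    simp only
    rw [abs_of_nonneg (hnonneg i x)]
    refine (hi x hx).trans (le_of_eq ?_)
    field_simp
    norm_num
  have hge : 0 ≤ sSup ((fun x => |φ i x|) '' d.Ω₂) := by
    refine Real.sSup_nonneg ?_
    rintro _ ⟨x, -, rfl⟩
    exact abs_nonneg _
  rw [Real.dist_eq, sub_zero, abs_of_nonneg hge]
  linarith
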